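/- arXiv:2001.06359 — 6 statements merged into one kernel-verified Lean document; each statement's English description precedes it below -/
import Mathlib

section
/- Let k be an algebraically closed field and n a positive integer. Then the general linear group GL_n(k) has only finitely many z-classes, i.e. the set of equivalence classes of GL_n(k) under z-equivalence is finite. -/
/-- Two elements of a group are *z-equivalent* if their centralizers are conjugate:
there is `a` with `a ⬝ Z(g) ⬝ a⁻¹ = Z(h)`. -/
def IsZEquiv {G : Type*} [Group G] (g h : G) : Prop :=
  ∃ a : G, ∀ x : G, x ∈ Subgroup.centralizer {g} ↔ a * x * a⁻¹ ∈ Subgroup.centralizer {h}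

open Polynomial

theorem IsZEquiv.symm {G : Type*} [Group G] {g h : G} (H : IsZEquiv g h) : IsZEquiv h g := by
  obtain ⟨a, ha⟩ := H
  refine ⟨a⁻¹, fun x => ?_⟩
  rw [ha]
  simp [mul_assoc]

theorem IsZEquiv.trans {G : Type*} [Group G] {g h l : G} (H : IsZEquiv g h)
    (H' : IsZEquiv h l) : IsZEquiv g l := by
  obtain ⟨a, ha⟩ := H
  obtain ⟨b, hb⟩ := H'
  refine ⟨b * a, fun x => ?_⟩
  rw [ha, hb]
  simp [mul_assoc]

/-- If finitely many labels suffice to tell z-classes apart, there are finitely many z-classes. -/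
theorem finite_zClasses_of_label {G D : Type*} [Group G] [Finite D] (r : G → D → Prop)
    (hr : ∀ g, ∃ d, r g d) (h : ∀ g g' d, r g d → r g' d → IsZEquiv g g') :
    {C : Set G | ∃ g : G, C = {h : G | IsZEquiv g h}}.Finite := by
  choose d hd using hr
  refine Set.Finite.of_injOn (f := fun C => {x | ∃ g ∈ C, d g = x}) (t := Set.univ)
    (fun _ _ => Set.mem_univ _) ?_ Set.finite_univ
  rintro _ ⟨g, rfl⟩ _ ⟨g', rfl⟩ heq
  have hg : d g ∈ {x | ∃ a ∈ {h : G | IsZEquiv g' h}, d a = x} := by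
    exact heq.subset ⟨g, h g g _ (hd g) (hd g), rfl⟩
  obtain ⟨a, ha, hda⟩ := hg
  have hgg : IsZEquiv g' g := ha.trans (h a g _ (hda ▸ hd a) (hd g))
  ext x
  exact ⟨hgg.trans, hgg.symm.trans⟩

/-- The model of a nilpotent Jordan block of size `e`, on which `X` acts. -/
abbrev NilBlock (k : Type*) [Field k] (e : ℕ) : Type _ := k[X] ⧸ Ideal.span {(X : k[X]) ^ e}

/-- The element of `∏ i, k[X]/(X ^ e i)` acting as a Jordan block with eigenvalue `c i` on the
`i`-th factor. -/
noncomputable def jordanElt {k : Type*} [Field k] {ι : Type*} (e : ι → ℕ) (c : ι → k) :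
    ∀ i, NilBlock k (e i) :=
  fun i => algebraMap k _ (c i) + Ideal.Quotient.mk _ X

/-- `A` is a direct sum of Jordan blocks of sizes `e i` and eigenvalues `c i`. -/
def HasJordanType {k V : Type*} [Field k] [AddCommGroup V] [Module k V] {ι : Type*}
    (A : Module.End k V) (e : ι → ℕ) (c : ι → k) : Prop :=
  ∃ φ : V ≃ₗ[k] (∀ i, NilBlock k (e i)), ∀ v, φ (A v) = jordanElt e c * φ v

/-- Hermite interpolation to first order. -/
theorem exists_pow_dvd_sub_X_add_C {k : Type*} [Field k] {ι : Type*} [Finite ι] (c d : ι → k)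
    (hcd : ∀ i j, c i = c j → d i = d j) (N : ℕ) :
    ∃ p : k[X], ∀ i, (X - C (c i)) ^ N ∣ p - (X + C (d i - c i)) := by
  have hcop : Pairwise (Function.onFun IsCoprime
      fun a : Set.range c => Ideal.span {(X - C (a : k)) ^ N}) := by
    intro a b hab
    rw [Function.onFun, Ideal.isCoprime_span_singleton_iff]
    refine (isCoprime_X_sub_C_of_isUnit_sub ?_).pow
    exact (sub_ne_zero.2 fun h => hab (Subtype.ext h)).isUnit
  choose s hs using fun a : Set.range c => a.2
  obtain ⟨p, hp⟩ := Ideal.exists_forall_sub_mem_ideal hcop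
    fun a => X + C (d (s a) - (a : k))
  refine ⟨p, fun i => ?_⟩
  have := Ideal.mem_span_singleton.1 (hp ⟨c i, i, rfl⟩)
  rwa [hcd (s ⟨c i, i, rfl⟩) i (hs ⟨c i, i, rfl⟩)] at this

theorem exists_aeval_jordanElt_eq {k : Type*} [Field k] {ι : Type*} [Finite ι] (e : ι → ℕ)
    (c d : ι → k) (hcd : ∀ i j, c i = c j → d i = d j) :
    ∃ p : k[X], aeval (jordanElt e c) p = jordanElt e d := by
  obtain ⟨N, hN⟩ := (Set.finite_range e).bddAbove
  obtain ⟨p, hp⟩ := exists_pow_dvd_sub_X_add_C c d hcd N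
  refine ⟨p, funext fun i => ?_⟩
  obtain ⟨q, hq⟩ := (pow_dvd_pow (X - C (c i)) (hN ⟨i, rfl⟩)).trans (hp i)
  have hX : (Ideal.Quotient.mk (Ideal.span {(X : k[X]) ^ e i}) X) ^ e i = 0 := by
    rw [← map_pow]
    exact Ideal.Quotient.eq_zero_iff_mem.2 (Ideal.mem_span_singleton_self _)
  have happ : aeval (jordanElt e c) p i = aeval (jordanElt e c i) p :=
    (aeval_algHom_apply (Pi.evalAlgHom k (fun i => NilBlock k (e i)) i) (jordanElt e c) p).symm
  rw [happ, sub_eq_iff_eq_add.1 hq]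
  simp only [jordanElt, map_add, map_mul, map_pow, map_sub, aeval_X, aeval_C, add_sub_cancel_left,
    hX, zero_mul, zero_add]
  abel

/-- An endomorphism commuting with multiplication by `x` commutes with multiplication by
any polynomial in `x`. -/
theorem map_aeval_mul_of_map_mul {k R : Type*} [CommSemiring k] [CommSemiring R] [Algebra k R]
    (f : Module.End k R) (x : R) (hf : ∀ v, f (x * v) = x * f v) (p : k[X]) (v : R) :
    f (aeval x p * v) = aeval x p * f v := by
  induction p using Polynomial.induction_on generalizing v with
  | C a => simp [← Algebra.smul_def]
  | add p q hp hq => simp only [map_add, add_mul, hp, hq]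
  | monomial n a h =>
    rw [pow_succ, ← mul_assoc, map_mul (aeval x), aeval_X, mul_assoc, h, hf, mul_assoc]

theorem map_jordanElt_mul {k : Type*} [Field k] {ι : Type*} [Finite ι] (e : ι → ℕ)
    (c d : ι → k) (hcd : ∀ i j, c i = c j → d i = d j)
    (f : Module.End k (∀ i, NilBlock k (e i)))
    (hf : ∀ v, f (jordanElt e c * v) = jordanElt e c * f v) (v : ∀ i, NilBlock k (e i)) :
    f (jordanElt e d * v) = jordanElt e d * f v := by
  obtain ⟨p, hp⟩ := exists_aeval_jordanElt_eq e c d hcd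
  rw [← hp]
  exact map_aeval_mul_of_map_mul f _ hf p v

/-- The centralizer of an endomorphism is determined up to conjugacy by its Jordan block sizes
and the coincidences among its eigenvalues. -/
theorem HasJordanType.exists_conj_commute_iff {k V : Type*} [Field k] [AddCommGroup V]
    [Module k V] {ι : Type*} [Finite ι] {A B : Module.End k V} {e : ι → ℕ} {c d : ι → k}
    (hA : HasJordanType A e c) (hB : HasJordanType B e d)
    (hcd : ∀ i j, c i = c j ↔ d i = d j) :
    ∃ a : (Module.End k V)ˣ, ∀ f : Module.End k V,
      Commute f A ↔ Commute (a * f * (a⁻¹ : (Module.End k V)ˣ)) B := by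
  obtain ⟨φ, hφ⟩ := hA
  obtain ⟨ψ, hψ⟩ := hB
  have key : ∀ {C : Module.End k V} {c : ι → k} (φ : V ≃ₗ[k] (∀ i, NilBlock k (e i)))
      (_ : ∀ v, φ (C v) = jordanElt e c * φ v) (f : Module.End k V),
      Commute f C ↔ ∀ v, φ.conj f (jordanElt e c * v) = jordanElt e c * φ.conj f v := by
    intro C c φ hφ f
    have hs : ∀ v, φ.symm (jordanElt e c * v) = C (φ.symm v) := fun v => by
      rw [LinearEquiv.symm_apply_eq, hφ, φ.apply_symm_apply]
    simp only [LinearEquiv.conj_apply_apply, hs, ← hφ, φ.injective.eq_iff]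
    exact ⟨fun h v => LinearMap.congr_fun h _,
      fun h => LinearMap.ext fun v => by simpa using h (φ v)⟩
  refine ⟨LinearMap.GeneralLinearGroup.ofLinearEquiv (φ.trans ψ.symm), fun f => ?_⟩
  rw [key φ hφ, key ψ hψ]
  have hconj : ψ.conj ((LinearMap.GeneralLinearGroup.ofLinearEquiv (φ.trans ψ.symm) :
      (Module.End k V)ˣ) * f *
      ((LinearMap.GeneralLinearGroup.ofLinearEquiv (φ.trans ψ.symm))⁻¹ : (Module.End k V)ˣ)) =
      φ.conj f := by
    ext v : 1
    change ψ (ψ.symm (φ (f (φ.symm (ψ (ψ.symm v)))))) = _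
    simp [LinearEquiv.conj_apply_apply]
  rw [hconj]
  exact ⟨map_jordanElt_mul e c d (fun i j => (hcd i j).1) _,
    map_jordanElt_mul e d c (fun i j => (hcd i j).2) _⟩

theorem exists_algEquiv_nilBlock {k : Type*} [Field k] [IsAlgClosed k] {p : k[X]}
    (hp : Irreducible p) (e : ℕ) :
    ∃ (c : k) (τ : (k[X] ⧸ Ideal.span {p ^ e}) ≃ₐ[k] NilBlock k e),
      τ (Ideal.Quotient.mk _ X) = algebraMap k _ c + Ideal.Quotient.mk _ X := by
  obtain ⟨c, hc⟩ := IsAlgClosed.exists_root p (by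
    rw [IsAlgClosed.degree_eq_one_of_irreducible k hp]; exact one_ne_zero)
  have hass : Associated (X - C c) p :=
    (irreducible_X_sub_C c).associated_of_dvd hp (dvd_iff_isRoot.2 hc)
  have hspan : Ideal.span {p ^ e} = Ideal.span {(X - C c) ^ e} :=
    (Ideal.span_singleton_eq_span_singleton.2 hass.pow_pow).symm
  refine ⟨c, Ideal.quotientEquivAlg _ _ (taylorEquiv c) ?_, ?_⟩
  · rw [hspan, Ideal.map_span]
    simp [taylorEquiv]
  · refine Eq.trans (b := Ideal.Quotient.mk _ X + Ideal.Quotient.mk _ (C c)) ?_ (add_comm _ _)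
    simp [Ideal.quotientEquivAlg, taylorEquiv]

/-- Factors that are zero may be dropped from a product of modules. -/
theorem bijective_funLeft_of_subsingleton {R : Type*} [Semiring R] {ι κ : Type*}
    {M : ι → Type*} [∀ i, AddCommMonoid (M i)] [∀ i, Module R (M i)] (s : κ → ι)
    (hs : Function.Injective s) (h : ∀ i, i ∉ Set.range s → Subsingleton (M i)) :
    Function.Bijective (LinearMap.pi fun j => LinearMap.proj (R := R) (φ := M) (s j)) := by
  classical
  refine ⟨fun x y hxy => funext fun i => ?_, fun y => ?_⟩
  · by_cases hi : i ∈ Set.range s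
    · obtain ⟨j, rfl⟩ := hi
      exact congr_fun hxy j
    · have := h i hi
      exact Subsingleton.elim _ _
  · refine ⟨fun i => if hi : ∃ j, s j = i then hi.choose_spec ▸ y hi.choose else 0,
      funext fun j => ?_⟩
    have hj : ∃ j', s j' = s j := ⟨j, rfl⟩
    have hcast : ∀ j' (h : s j' = s j), h ▸ y j' = y j := by
      intro j' h
      obtain rfl := hs h
      rfl
    simp only [LinearMap.pi_apply, LinearMap.proj_apply, dif_pos hj]
    exact hcast _ _

theorem finrank_nilBlock (k : Type*) [Field k] (e : ℕ) :
    Module.finrank k (NilBlock k e) = e := by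
  rw [finrank_quotient_span_eq_natDegree, natDegree_X_pow]

theorem exists_hasJordanType {k V : Type*} [Field k] [IsAlgClosed k] [AddCommGroup V]
    [Module k V] [FiniteDimensional k V] (A : Module.End k V) :
    ∃ (m : ℕ) (e : Fin m → ℕ) (c : Fin m → k), m ≤ Module.finrank k V ∧
      (∀ i, e i ≤ Module.finrank k V) ∧ HasJordanType A e c := by
  classical
  obtain ⟨ι, _, p, hp, e, ⟨Φ⟩⟩ := Module.equiv_directSum_of_isTorsion
    (Module.AEval.isTorsion_of_finiteDimensional k V A)
  choose c τ hτ using fun i => exists_algEquiv_nilBlock (hp i) (e i)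
  let s : Fin (Fintype.card {i // e i ≠ 0}) → ι := fun j => ((Fintype.equivFin _).symm j).1
  have hs : Function.Injective s := Subtype.val_injective.comp (Equiv.injective _)
  have hsub : ∀ i, i ∉ Set.range s → Subsingleton (NilBlock k (e i)) := by
    intro i hi
    have he : e i = 0 := by
      by_contra h
      exact hi ⟨Fintype.equivFin _ ⟨i, h⟩, by simp [s]⟩
    rw [he]
    exact Ideal.Quotient.subsingleton_iff.2 (by simp)
  let φ : V ≃ₗ[k] ∀ j, NilBlock k (e (s j)) :=
    (Module.AEval'.of A).trans <|
      ((Φ.trans (DirectSum.linearEquivFunOnFintype _ _ _)).restrictScalars k).trans <|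
      (LinearEquiv.piCongrRight fun i => (τ i).toLinearEquiv).trans <|
      LinearEquiv.ofBijective _ (bijective_funLeft_of_subsingleton s hs hsub)
  have hsum : Module.finrank k V = ∑ j, e (s j) := by
    have hfin : ∀ j, Module.Finite k (NilBlock k (e (s j))) := fun j =>
      (monic_X_pow (e (s j))).finite_quotient
    rw [φ.finrank_eq, Module.finrank_pi_fintype]
    simp [finrank_nilBlock]
  refine ⟨_, fun j => e (s j), fun j => c (s j), ?_, fun j => ?_, φ, fun v => funext fun j => ?_⟩
  · rw [hsum]
    calc _ = ∑ j : Fin (Fintype.card {i // e i ≠ 0}), 1 := by simp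
      _ ≤ _ := Finset.sum_le_sum fun j _ =>
        Nat.one_le_iff_ne_zero.2 ((Fintype.equivFin {i // e i ≠ 0}).symm j).2
  · rw [hsum]
    exact Finset.single_le_sum (f := fun j => e (s j)) (fun _ _ => Nat.zero_le _)
      (Finset.mem_univ j)
  · have h1 : φ (A v) j = τ (s j) ((Ideal.Quotient.mk _ X) *
        DirectSum.linearEquivFunOnFintype k[X] _ _ (Φ (Module.AEval'.of A v)) (s j)) := by
      change τ (s j) (DirectSum.linearEquivFunOnFintype k[X] _ _
        (Φ (Module.AEval'.of A (A v))) (s j)) = _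
      rw [← Module.AEval'.X_smul_of, map_smul, map_smul]
      rfl
    rw [h1, map_mul, hτ]
    rfl

/-- Over an algebraically closed field `k`, the general linear group `GL n k` has only
finitely many z-classes. -/
theorem finitely_many_zClasses_GL_of_isAlgClosed (k : Type*) [Field k] [IsAlgClosed k]
    (n : ℕ) (hn : 0 < n) :
    {C : Set (GL (Fin n) k) | ∃ g : GL (Fin n) k, C = {h : GL (Fin n) k | IsZEquiv g h}}.Finite := by
  let T : Matrix (Fin n) (Fin n) k ≃ₐ[k] Module.End k (Fin n → k) := Matrix.toLinAlgEquiv'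
  refine finite_zClasses_of_label
    (D := Σ m : Fin (n + 1), (Fin m → Fin (n + 1)) × (Fin m → Fin m → Prop))
    (fun g d => ∃ c : Fin d.1 → k, (∀ i j, c i = c j ↔ d.2.2 i j) ∧
      HasJordanType (T g) (fun i => (d.2.1 i : ℕ)) c) ?_ ?_
  · intro g
    obtain ⟨m, e, c, hm, he, h⟩ := exists_hasJordanType (T g)
    rw [Module.finrank_fin_fun] at hm he
    exact ⟨⟨⟨m, Nat.lt_succ_of_le hm⟩, fun i => ⟨e i, Nat.lt_succ_of_le (he i)⟩,
      fun i j => c i = c j⟩, c, fun _ _ => Iff.rfl, h⟩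
  · rintro g g' d ⟨c, hc, h⟩ ⟨c', hc', h'⟩
    obtain ⟨a, ha⟩ := h.exists_conj_commute_iff h' fun i j => (hc i j).trans (hc' i j).symm
    have hT : ∀ x y : GL (Fin n) k, x ∈ Subgroup.centralizer {y} ↔
        Commute (T x) (T y) := fun x y => by
      rw [Subgroup.mem_centralizer_singleton_iff, commute_iff_eq, ← map_mul, ← map_mul,
        T.injective.eq_iff, Units.ext_iff, Units.val_mul, Units.val_mul]
    let U := Units.mapEquiv T.toMulEquiv
    refine ⟨U.symm a, fun x => ?_⟩
    rw [hT, hT, ha]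
    have h1 : T (U.symm a : GL (Fin n) k) = a := congr_arg Units.val (U.apply_symm_apply a)
    have h2 : T ((U.symm a)⁻¹ : GL (Fin n) k) = (a⁻¹ : (Module.End k (Fin n → k))ˣ) := by
      rw [← map_inv]
      exact congr_arg Units.val (U.apply_symm_apply a⁻¹)
    rw [Units.val_mul, Units.val_mul, map_mul, map_mul, h1, h2]
end

section
/- Let k be an infinite field, L a field extension of k, and n a positive integer. If g, h ∈ GL_n(k) are z-equivalent in GL_n(k), then their images in GL_n(L) are z-equivalent in GL_n(L). More precisely, if a ∈ GL_n(k) satisfies a·Z_{GL_n(k)}(g)·a⁻¹ = Z_{GL_n(k)}(h), then the image of a conjugates the centralizer of (the image of) g in GL_n(L) onto the centralizer of (the image of) h in GL_n(L). -/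
/-- The entrywise base-change group homomorphism `GL n k →* GL n L` induced by the
inclusion `k ↪ L`. -/
noncomputable def glMap (k L : Type*) [Field k] [Field L] [Algebra k L] (n : ℕ) :
    GL (Fin n) k →* GL (Fin n) L :=
  Units.map ((algebraMap k L).mapMatrix).toMonoidHom

/-- Over an infinite field, every square matrix has an invertible translate by a scalar. -/
lemma exists_isUnit_add_scalar {k m : Type*} [Field k] [Infinite k] [Fintype m] [DecidableEq m]
    (X : Matrix m m k) : ∃ c : k, IsUnit (X + Matrix.scalar m c) := by
  classical
  obtain ⟨c, hc⟩ := Infinite.exists_notMem_finset (-X).charpoly.roots.toFinset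
  refine ⟨c, ?_⟩
  rw [Matrix.isUnit_iff_isUnit_det, isUnit_iff_ne_zero]
  intro h0
  apply hc
  rw [Multiset.mem_toFinset, Polynomial.mem_roots (Matrix.charpoly_monic _).ne_zero,
    Polynomial.IsRoot.def, Matrix.eval_charpoly, sub_neg_eq_add, add_comm]
  exact h0

/-- Over an infinite field, an inclusion of centralizers in the general linear group extends to
the matrix algebra. -/
lemma commute_of_forall_units_commute {k m : Type*} [Field k] [Infinite k] [Fintype m]
    [DecidableEq m] {A B : Matrix m m k}
    (hAB : ∀ x : (Matrix m m k)ˣ, Commute (x : Matrix m m k) A → Commute (x : Matrix m m k) B)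
    {X : Matrix m m k} (hX : Commute X A) : Commute X B := by
  obtain ⟨c, u, hu⟩ := exists_isUnit_add_scalar X
  have hs (M : Matrix m m k) : Commute (Matrix.scalar m c) M :=
    Matrix.scalar_commute c (fun r => Commute.all c r) M
  have h := hAB u (hu ▸ hX.add_left (hs A))
  rw [hu] at h
  simpa using h.sub_left (hs B)

/-- Applying a linear functional entrywise is linear for multiplication by scalar-extended
matrices on either side, so an inclusion of centralizers persists under field extension. -/
lemma commute_map_of_forall_commute {k L m : Type*} [Field k] [Field L] [Algebra k L] [Fintype m]
    {A B : Matrix m m k} (hAB : ∀ X : Matrix m m k, Commute X A → Commute X B)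
    {Y : Matrix m m L} (hY : Commute Y (A.map (algebraMap k L))) :
    Commute Y (B.map (algebraMap k L)) := by
  have hr (φ : Module.Dual k L) (C : Matrix m m k) :
      (Y * C.map (algebraMap k L)).map φ = Y.map φ * C := by
    ext i j
    simp only [Matrix.map_apply, Matrix.mul_apply, map_sum]
    refine Finset.sum_congr rfl fun l _ => ?_
    rw [mul_comm, ← Algebra.smul_def, map_smul, smul_eq_mul, mul_comm]
  have hl (φ : Module.Dual k L) (C : Matrix m m k) :
      (C.map (algebraMap k L) * Y).map φ = C * Y.map φ := by
    ext i j
    simp only [Matrix.map_apply, Matrix.mul_apply, map_sum]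
    refine Finset.sum_congr rfl fun l _ => ?_
    rw [← Algebra.smul_def, map_smul, smul_eq_mul]
  have key (φ : Module.Dual k L) : Commute (Y.map φ) B :=
    hAB _ (by rw [Commute, SemiconjBy, ← hr, ← hl, hY.eq])
  rw [Commute, SemiconjBy]
  ext i j
  rw [← sub_eq_zero, ← Module.forall_dual_apply_eq_zero_iff k]
  intro φ
  rw [map_sub, sub_eq_zero]
  have h := (key φ).eq
  rw [← hr, ← hl] at h
  exact congrFun (congrFun h i) j

/-- An inclusion of centralizers in `GL n k` over an infinite field `k` persists in `GL n L`. -/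
lemma commute_glMap_of_forall_commute {k L : Type*} [Field k] [Infinite k] [Field L] [Algebra k L]
    {n : ℕ} {g h : GL (Fin n) k} (hgh : ∀ x : GL (Fin n) k, Commute x g → Commute x h)
    {y : GL (Fin n) L} (hy : Commute y (glMap k L n g)) : Commute y (glMap k L n h) := by
  rw [← Commute.units_val_iff] at hy ⊢
  refine commute_map_of_forall_commute (A := (g : Matrix (Fin n) (Fin n) k)) (fun X hX => ?_) hy
  exact commute_of_forall_units_commute
    (fun x hx => (hgh x (Commute.units_val_iff.mp hx)).units_val) hX

/-- A conjugate `a * x * a⁻¹` centralizes `h` iff `x` commutes with `a⁻¹ * h * a`. -/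
lemma conj_mem_centralizer_singleton_iff {G : Type*} [Group G] {a x h : G} :
    a * x * a⁻¹ ∈ Subgroup.centralizer {h} ↔ Commute x (a⁻¹ * h * a) := by
  rw [Subgroup.mem_centralizer_singleton_iff, ← Commute.conj_iff a, Commute, SemiconjBy]
  simp only [mul_assoc, mul_inv_cancel_left, mul_inv_cancel, mul_one]

/-- Let `k` be an infinite field and `L` a field extension of `k`.  If
`a ∈ GL n k` conjugates the centralizer of `g` in `GL n k` onto the centralizer of `h`
in `GL n k`, then the image of `a` in `GL n L` conjugates the centralizer of the image of
`g` in `GL n L` onto the centralizer of the image of `h`.  In particular, if `g` and `h`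
are z-equivalent in `GL n k`, then they are z-equivalent in `GL n L`. -/
theorem zEquiv_base_change (k L : Type*) [Field k] [Infinite k] [Field L] [Algebra k L]
    (n : ℕ) (hn : 0 < n) (g h a : GL (Fin n) k)
    (ha : ∀ x : GL (Fin n) k,
      x ∈ Subgroup.centralizer {g} ↔ a * x * a⁻¹ ∈ Subgroup.centralizer {h}) :
    ∀ y : GL (Fin n) L,
      y ∈ Subgroup.centralizer {glMap k L n g} ↔
        glMap k L n a * y * (glMap k L n a)⁻¹ ∈ Subgroup.centralizer {glMap k L n h} := by
  have hc (x : GL (Fin n) k) : Commute x g ↔ Commute x (a⁻¹ * h * a) := by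
    rw [← conj_mem_centralizer_singleton_iff, ← ha, Subgroup.mem_centralizer_singleton_iff,
      Commute, SemiconjBy]
  intro y
  rw [conj_mem_centralizer_singleton_iff, ← map_inv, ← map_mul, ← map_mul,
    Subgroup.mem_centralizer_singleton_iff]
  exact ⟨fun hy => commute_glMap_of_forall_commute (fun x => (hc x).mp) hy,
    fun hy => (commute_glMap_of_forall_commute (fun x => (hc x).mpr) hy).eq⟩
end

section
/- Let k be a perfect field and n ≥ 2 an integer. Suppose there are infinitely many intermediate fields of k̄/k (k̄ an algebraic closure of k) that have degree n over k and are pairwise non-isomorphic as k-algebras. Then GL_n(k) has infinitely many z-classes; in fact there are infinitely many pairwise non-z-equivalent semisimple elements of GL_n(k) (elements whose minimal polynomial is squarefree, equivalently which are diagonalizable over k̄). -/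
theorem IsZEquiv.refl {G : Type*} [Group G] (g : G) : IsZEquiv g g :=
  ⟨1, fun x => by simp⟩

/-- The conjugate of `g` commutes with `h` whenever `g` and `h` are z-equivalent. -/
theorem IsZEquiv.exists_commute_conj {G : Type*} [Group G] {g h : G} (hgh : IsZEquiv g h) :
    ∃ a : G, Commute (a * g * a⁻¹) h := by
  obtain ⟨a, ha⟩ := hgh
  refine ⟨a, ?_⟩
  have := (ha g).1 (Subgroup.mem_centralizer_singleton_iff.2 rfl)
  exact Subgroup.mem_centralizer_singleton_iff.1 this

/-- A matrix commuting with multiplication by a generator of a commutative algebra is itself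
a multiplication matrix. -/
theorem Algebra.exists_leftMulMatrix_eq_of_commute {k L ι : Type*} [Field k] [CommRing L]
    [Algebra k L] [Fintype ι] [DecidableEq ι] (b : Module.Basis ι k L) {θ : L}
    (hθ : Algebra.adjoin k {θ} = ⊤) {A : Matrix ι ι k}
    (hA : Commute A (Algebra.leftMulMatrix b θ)) :
    ∃ y : L, Algebra.leftMulMatrix b y = A := by
  have hcomm (x : L) : Commute (Algebra.leftMulMatrix b x) A := by
    have hx : x ∈ Algebra.adjoin k {θ} := hθ ▸ Algebra.mem_top
    induction hx using Algebra.adjoin_induction with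
    | mem x hx => rw [Set.mem_singleton_iff.1 hx]; exact hA.symm
    | algebraMap r => rw [AlgHom.commutes]; exact Algebra.commutes r A
    | add x y _ _ hx hy => rw [map_add]; exact hx.add_left hy
    | mul x y _ _ hx hy => rw [map_mul]; exact hx.mul_left hy
  refine ⟨Matrix.toLin b b A 1, (Matrix.toLin b b).injective (LinearMap.ext fun x => ?_)⟩
  have h := congrArg (fun M => Matrix.toLin b b M 1) (hcomm x).eq
  simp only [Matrix.toLin_mul b b b, LinearMap.comp_apply, Algebra.leftMulMatrix_apply,
    Matrix.toLin_toMatrix, Algebra.coe_lmul_eq_mul, LinearMap.mul_apply', mul_one] at h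
  simp only [Algebra.leftMulMatrix_apply, Matrix.toLin_toMatrix, Algebra.coe_lmul_eq_mul,
    LinearMap.mul_apply', mul_comm _ x, h]

theorem Polynomial.aeval_units_conj {k R : Type*} [CommSemiring k] [Ring R] [Algebra k R]
    (p : Polynomial k) (u : Rˣ) (x : R) :
    Polynomial.aeval (u * x * ↑u⁻¹ : R) p = u * Polynomial.aeval x p * ↑u⁻¹ := by
  simpa [ConjAct.units_smul_def] using
    (Polynomial.aeval_algHom_apply
      (MulSemiringAction.toAlgHom k R (ConjAct.toConjAct u)) x p)

/-- If multiplication by generators of two fields of the same degree gives z-equivalent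
matrices, then the fields are isomorphic. -/
theorem nonempty_algEquiv_of_isZEquiv {k L₁ L₂ ι : Type*} [Field k] [Field L₁] [Field L₂]
    [Algebra k L₁] [Algebra k L₂] [Fintype ι] [DecidableEq ι]
    (b₁ : Module.Basis ι k L₁) (b₂ : Module.Basis ι k L₂)
    (pb₁ : PowerBasis k L₁) (pb₂ : PowerBasis k L₂) {g₁ g₂ : GL ι k}
    (hg₁ : (g₁ : Matrix ι ι k) = Algebra.leftMulMatrix b₁ pb₁.gen)
    (hg₂ : (g₂ : Matrix ι ι k) = Algebra.leftMulMatrix b₂ pb₂.gen)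
    (hz : IsZEquiv g₁ g₂) : Nonempty (L₁ ≃ₐ[k] L₂) := by
  obtain ⟨a, ha⟩ := hz.exists_commute_conj
  have hc : Commute ((a : Matrix ι ι k) * g₁ * (a⁻¹ : GL ι k))
      (Algebra.leftMulMatrix b₂ pb₂.gen) := by
    rw [← hg₂]
    exact congrArg Units.val ha.eq
  obtain ⟨y, hy⟩ := Algebra.exists_leftMulMatrix_eq_of_commute b₂ pb₂.adjoin_gen_eq_top hc
  have hroot : Polynomial.aeval y (minpoly k pb₁.gen) = 0 := by
    apply Algebra.leftMulMatrix_injective b₂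
    rw [← Polynomial.aeval_algHom_apply, hy, Polynomial.aeval_units_conj, hg₁,
      Polynomial.aeval_algHom_apply, minpoly.aeval]
    simp
  have := b₁.finiteDimensional_of_finite
  have := b₂.finiteDimensional_of_finite
  let f := pb₁.lift y hroot
  have hf : Function.Injective f.toLinearMap := f.toRingHom.injective
  have hrank : Module.finrank k L₁ = Module.finrank k L₂ := by
    rw [Module.finrank_eq_card_basis b₁, Module.finrank_eq_card_basis b₂]
  exact ⟨AlgEquiv.ofBijective f
    ⟨hf, (LinearMap.injective_iff_surjective_of_finrank_eq_finrank hrank).1 hf⟩⟩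

theorem PowerBasis.gen_ne_zero {k L : Type*} [Field k] [Field L] [Algebra k L]
    (pb : PowerBasis k L) (h : Module.finrank k L ≠ 1) : pb.gen ≠ 0 := by
  intro h0
  apply h
  have htop := pb.adjoin_gen_eq_top
  rw [h0, Algebra.adjoin_singleton_zero] at htop
  exact Subalgebra.bot_eq_top_iff_finrank_eq_one.1 htop

/-- Let `k` be a perfect field and `n ≥ 2`.  If there are infinitely many intermediate
fields of `k̄/k` of degree `n` over `k` that are pairwise non-isomorphic as `k`-algebras,
then `GL n k` has infinitely many z-classes; indeed there is an infinite family of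
semisimple elements (squarefree minimal polynomial) that are pairwise not z-equivalent. -/
theorem infinitely_many_zClasses_GL_of_not_typeF (k : Type*) [Field k] [PerfectField k]
    (n : ℕ) (hn : 2 ≤ n)
    (K : ℕ → IntermediateField k (AlgebraicClosure k))
    (hdeg : ∀ i, Module.finrank k (K i) = n)
    (hiso : ∀ i j, i ≠ j → IsEmpty ((K i) ≃ₐ[k] (K j))) :
    {C : Set (GL (Fin n) k) |
      ∃ g : GL (Fin n) k, C = {h : GL (Fin n) k | IsZEquiv g h}}.Infinite ∧
    ∃ g : ℕ → GL (Fin n) k,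
      (∀ i, Squarefree (minpoly k ((g i : Matrix (Fin n) (Fin n) k)))) ∧
      (∀ i j, i ≠ j → ¬ IsZEquiv (g i) (g j)) := by
  have hfin (i : ℕ) : FiniteDimensional k (K i) :=
    FiniteDimensional.of_finrank_pos (by rw [hdeg i]; lia)
  let b (i : ℕ) : Module.Basis (Fin n) k (K i) := Module.finBasisOfFinrankEq k (K i) (hdeg i)
  let pb (i : ℕ) : PowerBasis k (K i) := Field.powerBasisOfFiniteOfSeparable k (K i)
  have hne (i : ℕ) : (pb i).gen ≠ 0 := (pb i).gen_ne_zero (by rw [hdeg i]; lia)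
  let g (i : ℕ) : GL (Fin n) k :=
    Units.map (Algebra.leftMulMatrix (b i) : K i →* Matrix (Fin n) (Fin n) k)
      (Units.mk0 _ (hne i))
  have hg (i : ℕ) : (g i : Matrix (Fin n) (Fin n) k) =
      Algebra.leftMulMatrix (b i) (pb i).gen := rfl
  have hz (i j : ℕ) (hij : i ≠ j) : ¬ IsZEquiv (g i) (g j) := fun h =>
    not_isEmpty_iff.2 (nonempty_algEquiv_of_isZEquiv (b i) (b j) (pb i) (pb j) (hg i) (hg j) h)
      (hiso i j hij)
  refine ⟨?_, g, fun i => ?_, hz⟩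
  · refine Set.infinite_of_injective_forall_mem
      (f := fun i => {h : GL (Fin n) k | IsZEquiv (g i) h}) (fun i j hij => ?_)
      fun i => ⟨g i, rfl⟩
    by_contra hne
    have hj : g j ∈ {h : GL (Fin n) k | IsZEquiv (g j) h} := IsZEquiv.refl (g j)
    exact hz i j hne ((Set.ext_iff.1 hij (g j)).2 hj)
  · rw [hg, minpoly.algHom_eq _ (Algebra.leftMulMatrix_injective (b i))]
    exact (minpoly.irreducible (Algebra.IsIntegral.isIntegral _)).squarefree
end

section
/- Let n ≥ 2, let k be a perfect field whose characteristic is zero or does not divide n, and for β ∈ kˣ let u_β ∈ SL_n(k) be the matrix with 1's on the diagonal, β in position (1,2), 1 in positions (i, i+1) for 2 ≤ i ≤ n−1, and 0 elsewhere. Then for β, γ ∈ kˣ, the matrices u_β and u_γ are conjugate in SL_n(k) if and only if βγ⁻¹ is an n-th power in kˣ. -/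
/-- The matrix with `1`s on the diagonal, `β` in position `(0,1)`, `1` in positions
`(i, i+1)` for `i ≥ 1`, and `0` elsewhere. -/
def uMat (n : ℕ) {k : Type*} [Field k] (β : k) : Matrix (Fin n) (Fin n) k :=
  Matrix.of fun i j =>
    if (i : ℕ) = (j : ℕ) then 1
    else if (i : ℕ) + 1 = (j : ℕ) then (if (i : ℕ) = 0 then β else 1) else 0

theorem uMat_blockTriangular (n : ℕ) {k : Type*} [Field k] (β : k) :
    (uMat n β).BlockTriangular id := by
  intro i j hij
  have h : (j : ℕ) < (i : ℕ) := hij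
  simp only [uMat, Matrix.of_apply]
  rw [if_neg (by omega), if_neg (by omega)]

/-- The regular unipotent element `u_β ∈ SL n k`. -/
def uBeta (n : ℕ) {k : Type*} [Field k] (β : k) : Matrix.SpecialLinearGroup (Fin n) k :=
  ⟨uMat n β, by
    rw [Matrix.det_of_upperTriangular (uMat_blockTriangular n β)]
    simp [uMat]⟩

/-- The superdiagonal entry of `uMat` in row `i`. -/
def superdiagEntry {k : Type*} [Field k] (β : k) (i : ℕ) : k := if i = 0 then β else 1

theorem mul_uMat_apply_zero {k : Type*} [Field k] {m : ℕ} (β : k)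
    (A : Matrix (Fin (m + 1)) (Fin (m + 1)) k) (i : Fin (m + 1)) :
    (A * uMat (m + 1) β) i 0 = A i 0 := by
  have h (l : Fin (m + 1)) : uMat (m + 1) β l 0 = if l = 0 then 1 else 0 := by
    simp only [uMat, Matrix.of_apply, Fin.ext_iff, Fin.val_zero]
    split_ifs <;> first | omega | simp_all
  simp [Matrix.mul_apply, h]

theorem mul_uMat_apply_succ {k : Type*} [Field k] {m : ℕ} (β : k)
    (A : Matrix (Fin (m + 1)) (Fin (m + 1)) k) (i : Fin (m + 1)) (j : Fin m) :
    (A * uMat (m + 1) β) i j.succ =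
      A i j.succ + A i j.castSucc * superdiagEntry β j := by
  have h (l : Fin (m + 1)) : uMat (m + 1) β l j.succ =
      (if l = j.succ then 1 else 0) + (if l = j.castSucc then superdiagEntry β j else 0) := by
    simp only [uMat, superdiagEntry, Matrix.of_apply, Fin.ext_iff, Fin.val_succ, Fin.val_castSucc]
    split_ifs <;> first | omega | simp
  simp [Matrix.mul_apply, h, mul_add, Finset.sum_add_distrib]

theorem uMat_mul_apply_castSucc {k : Type*} [Field k] {m : ℕ} (β : k)
    (A : Matrix (Fin (m + 1)) (Fin (m + 1)) k) (i : Fin m) (j : Fin (m + 1)) :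
    (uMat (m + 1) β * A) i.castSucc j =
      A i.castSucc j + superdiagEntry β i * A i.succ j := by
  have h (l : Fin (m + 1)) : uMat (m + 1) β i.castSucc l =
      (if l = i.castSucc then 1 else 0) + (if l = i.succ then superdiagEntry β i else 0) := by
    simp only [uMat, superdiagEntry, Matrix.of_apply, Fin.ext_iff, Fin.val_succ, Fin.val_castSucc]
    split_ifs <;> first | omega | simp
  simp [Matrix.mul_apply, h, add_mul, Finset.sum_add_distrib]

section Intertwiner

variable {k : Type*} [Field k] {m : ℕ} {β γ : k} {A : Matrix (Fin (m + 1)) (Fin (m + 1)) k}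

theorem superdiagEntry_mul_apply_succ_zero
    (h : A * uMat (m + 1) β = uMat (m + 1) γ * A) (i : Fin m) :
    superdiagEntry γ i * A i.succ 0 = 0 := by
  have := congrFun (congrFun h i.castSucc) 0
  rw [mul_uMat_apply_zero, uMat_mul_apply_castSucc] at this
  simpa using this

theorem superdiagEntry_mul_apply_succ_succ
    (h : A * uMat (m + 1) β = uMat (m + 1) γ * A) (i j : Fin m) :
    superdiagEntry γ i * A i.succ j.succ = A i.castSucc j.castSucc * superdiagEntry β j := by
  have := congrFun (congrFun h i.castSucc) j.succ
  rw [mul_uMat_apply_succ, uMat_mul_apply_castSucc] at this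
  exact (add_left_cancel this).symm

/-- A matrix intertwining `uMat β` and `uMat γ` with `γ ≠ 0` is upper triangular. -/
theorem blockTriangular_of_mul_uMat_eq (hγ : γ ≠ 0)
    (h : A * uMat (m + 1) β = uMat (m + 1) γ * A) : A.BlockTriangular id := by
  have hc (i : ℕ) : superdiagEntry γ i ≠ 0 := by
    unfold superdiagEntry
    split_ifs <;> simp [hγ]
  intro i j
  induction j using Fin.induction generalizing i with
  | zero =>
    intro hij
    obtain ⟨i, rfl⟩ := Fin.exists_succ_eq.mpr (ne_of_gt hij)
    exact (mul_eq_zero.mp (superdiagEntry_mul_apply_succ_zero h i)).resolve_left (hc i)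
  | succ j ih =>
    intro hij
    obtain ⟨i, rfl⟩ := Fin.exists_succ_eq.mpr (Fin.ne_zero_of_lt hij)
    have h2 := superdiagEntry_mul_apply_succ_succ h i j
    rw [ih (i := i.castSucc) (Fin.castSucc_lt_castSucc_iff.mpr (Fin.succ_lt_succ_iff.mp hij)),
      zero_mul] at h2
    exact (mul_eq_zero.mp h2).resolve_left (hc i)

end Intertwiner

/-- The determinant of a matrix intertwining `uMat β` and `uMat γ`. -/
theorem det_of_mul_uMat_eq {k : Type*} [Field k] {m : ℕ} {β γ : k} (hγ : γ ≠ 0)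
    {A : Matrix (Fin (m + 2)) (Fin (m + 2)) k}
    (h : A * uMat (m + 2) β = uMat (m + 2) γ * A) :
    A.det = A 0 0 * (A 1 1) ^ (m + 1) ∧ γ * A 1 1 = A 0 0 * β := by
  have h1 : γ * A 1 1 = A 0 0 * β := by
    simpa [superdiagEntry] using superdiagEntry_mul_apply_succ_succ h 0 0
  have hd (i : Fin (m + 1)) : A i.succ i.succ = A 1 1 := by
    induction i using Fin.induction with
    | zero => rfl
    | succ i ih =>
      have := superdiagEntry_mul_apply_succ_succ h i.succ i.succ
      simp only [superdiagEntry, Fin.val_succ, Nat.succ_ne_zero, if_false, one_mul, mul_one] at this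
      rw [this, ← Fin.succ_castSucc, ih]
  refine ⟨?_, h1⟩
  rw [Matrix.det_of_isUpperTriangular (blockTriangular_of_mul_uMat_eq hγ h), Fin.prod_univ_succ]
  simp [hd]

/-- The diagonal matrix with entries `c, d, …, d`, where `c * β = γ * d`, intertwines
`uMat β` and `uMat γ`. -/
theorem diagonal_mul_uMat {k : Type*} [Field k] {m : ℕ} {β γ c d : k} (h : c * β = γ * d) :
    Matrix.diagonal (Fin.cons c fun _ : Fin (m + 1) => d) * uMat (m + 2) β =
      uMat (m + 2) γ * Matrix.diagonal (Fin.cons c fun _ : Fin (m + 1) => d) := by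
  ext i j
  rw [Matrix.diagonal_mul, Matrix.mul_diagonal]
  cases i using Fin.cases <;> cases j using Fin.cases <;> simp [uMat]
  · split_ifs <;> simp [h]

/-- Let `n ≥ 2` and let `k` be a perfect field whose characteristic is zero or prime
to `n`.  For `β, γ ∈ kˣ`, the matrices `u_β` and `u_γ` are conjugate in `SL n k`
if and only if `βγ⁻¹` is an `n`-th power in `kˣ`. -/
theorem uBeta_conj_iff_nth_power (k : Type*) [Field k] [PerfectField k] (n : ℕ) (hn : 2 ≤ n)
    (hchar : ringChar k = 0 ∨ ¬ (ringChar k ∣ n)) (β γ : kˣ) :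
    (∃ a : Matrix.SpecialLinearGroup (Fin n) k,
      a * uBeta n (β : k) * a⁻¹ = uBeta n (γ : k)) ↔ (∃ δ : kˣ, β * γ⁻¹ = δ ^ n) := by
  obtain ⟨m, rfl⟩ := Nat.exists_eq_add_of_le' hn
  have hγ := γ.ne_zero
  simp only [mul_inv_eq_iff_eq_mul]
  constructor
  · rintro ⟨a, ha⟩
    have h : a.1 * uMat (m + 2) (β : k) = uMat (m + 2) (γ : k) * a.1 :=
      congrArg Subtype.val ha
    obtain ⟨hdet, h1⟩ := det_of_mul_uMat_eq hγ h
    rw [a.2] at hdet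
    have hne : a.1 1 1 ≠ 0 := fun h0 => by simp [h0] at hdet
    refine ⟨Units.mk0 _ hne, Units.ext ?_⟩
    push_cast
    rw [Units.val_mk0]
    linear_combination (β : k) * hdet - (a.1 1 1) ^ (m + 1) * h1
  · rintro ⟨δ, hδ⟩
    have hδ' : (β : k) = δ ^ (m + 2) * γ := by
      rw [hδ]
      push_cast
      rfl
    have h0 := δ.ne_zero
    refine ⟨⟨Matrix.diagonal (Fin.cons ((δ : k) ^ (m + 1))⁻¹ fun _ : Fin (m + 1) => (δ : k)), ?_⟩,
      Subtype.ext (diagonal_mul_uMat ?_)⟩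
    · rw [Matrix.det_diagonal, Fin.prod_univ_succ]
      simp [h0]
    · rw [hδ']
      field_simp
      ring
end

section
/- For every integer n ≥ 3, the group SL_n(ℚ) has infinitely many z-classes of unipotent elements: there exists an infinite family of unipotent elements of SL_n(ℚ) that are pairwise not z-equivalent in SL_n(ℚ). -/
namespace UnipotentZClasses

open Matrix

/-- The nilpotent Jordan block of size `n`. -/
def jordanBlock (n : ℕ) : Matrix (Fin n) (Fin n) ℚ :=
  Matrix.of fun i j => if (i : ℕ) + 1 = j then 1 else 0

lemma mul_jordanBlock_apply_succ {k : ℕ} (M : Matrix (Fin (k + 1)) (Fin (k + 1)) ℚ)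
    (i : Fin (k + 1)) (j : Fin k) : (M * jordanBlock (k + 1)) i j.succ = M i j.castSucc := by
  rw [Matrix.mul_apply, Finset.sum_eq_single j.castSucc]
  · simp [jordanBlock]
  · intro l _ hl
    have : (l : ℕ) ≠ j := fun h => hl (Fin.ext h)
    simp [jordanBlock, this]
  · simp

lemma mul_jordanBlock_apply_zero {k : ℕ} (M : Matrix (Fin (k + 1)) (Fin (k + 1)) ℚ)
    (i : Fin (k + 1)) : (M * jordanBlock (k + 1)) i 0 = 0 := by
  simp [Matrix.mul_apply, jordanBlock]

lemma jordanBlock_mul_apply_castSucc {k : ℕ} (M : Matrix (Fin (k + 1)) (Fin (k + 1)) ℚ)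
    (i : Fin k) (j : Fin (k + 1)) : (jordanBlock (k + 1) * M) i.castSucc j = M i.succ j := by
  rw [Matrix.mul_apply, Finset.sum_eq_single i.succ]
  · simp [jordanBlock]
  · intro l _ hl
    have : (i : ℕ) + 1 ≠ l := fun h => hl (Fin.ext h.symm)
    simp [jordanBlock, this]
  · simp

lemma isUpperTriangular_jordanBlock (n : ℕ) : (jordanBlock n).IsUpperTriangular := by
  intro i j hij
  have : (i : ℕ) + 1 ≠ j := by have : (j : ℕ) < i := hij; omega
  simp [jordanBlock, this]

lemma isNilpotent_jordanBlock (n : ℕ) : IsNilpotent (jordanBlock n) := by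
  refine ⟨n, ?_⟩
  have h := Matrix.aeval_self_charpoly (jordanBlock n)
  rw [Matrix.charpoly_of_isUpperTriangular _ (isUpperTriangular_jordanBlock n)] at h
  simpa [jordanBlock] using h

lemma det_one_add_jordanBlock (n : ℕ) : (1 + jordanBlock n).det = 1 := by
  rw [Matrix.det_of_isUpperTriangular
    (Matrix.blockTriangular_one.add (isUpperTriangular_jordanBlock n))]
  simp [jordanBlock]

section Commute

variable {k : ℕ} {M : Matrix (Fin (k + 1)) (Fin (k + 1)) ℚ}

lemma apply_succ_succ_of_commute (h : Commute M (jordanBlock (k + 1))) (i j : Fin k) :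
    M i.succ j.succ = M i.castSucc j.castSucc := by
  rw [← jordanBlock_mul_apply_castSucc M, ← mul_jordanBlock_apply_succ M, h.eq]

lemma apply_succ_zero_of_commute (h : Commute M (jordanBlock (k + 1))) (i : Fin k) :
    M i.succ 0 = 0 := by
  rw [← jordanBlock_mul_apply_castSucc M, ← h.eq, mul_jordanBlock_apply_zero]

lemma isUpperTriangular_of_commute (h : Commute M (jordanBlock (k + 1))) :
    M.IsUpperTriangular := by
  have key : ∀ j i : Fin (k + 1), j < i → M i j = 0 := by
    intro j
    induction j using Fin.induction with
    | zero =>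
      intro i hi
      obtain ⟨i, rfl⟩ := Fin.exists_succ_eq.mpr hi.ne'
      exact apply_succ_zero_of_commute h i
    | succ j ih =>
      intro i hi
      obtain ⟨i, rfl⟩ := Fin.exists_succ_eq.mpr (Fin.ne_zero_of_lt hi)
      rw [apply_succ_succ_of_commute h]
      exact ih _ (Fin.castSucc_lt_castSucc_iff.mpr (Fin.succ_lt_succ_iff.mp hi))
  exact fun i j hij => key j i hij

lemma diag_eq_of_commute (h : Commute M (jordanBlock (k + 1))) (i : Fin (k + 1)) :
    M i i = M 0 0 := by
  induction i using Fin.induction with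
  | zero => rfl
  | succ i ih => rw [apply_succ_succ_of_commute h, ih]

lemma diag_eq_zero_of_commute (h : Commute M (jordanBlock (k + 1))) (hM : IsNilpotent M)
    (i : Fin (k + 1)) : M i i = 0 := by
  have hdet : M.det = 0 := by
    obtain ⟨m, hm⟩ := hM
    refine eq_zero_of_pow_eq_zero (n := m + 1) ?_
    rw [← Matrix.det_pow, pow_succ, hm, zero_mul, Matrix.det_zero]
  rw [Matrix.det_of_isUpperTriangular (isUpperTriangular_of_commute h)] at hdet
  simp_rw [diag_eq_of_commute h] at hdet ⊢
  simpa using hdet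

lemma superdiag_eq_of_commute (h : Commute M (jordanBlock (k + 1))) (i j : Fin k) :
    M i.castSucc i.succ = M j.castSucc j.succ := by
  cases k with
  | zero => exact i.elim0
  | succ k =>
    have key : ∀ i : Fin (k + 1), M i.castSucc i.succ = M 0 1 := by
      intro i
      induction i using Fin.induction with
      | zero => rfl
      | succ i ih => rw [← Fin.succ_castSucc, apply_succ_succ_of_commute h, ← ih]; rfl
    rw [key, key]

end Commute

/-- If a matrix intertwines the Jordan block with a nilpotent matrix commuting with the Jordan
block, its determinant is of a special form. -/
lemma exists_det_eq_of_intertwine {k : ℕ} {b M : Matrix (Fin (k + 1)) (Fin (k + 1)) ℚ}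
    (hM : Commute M (jordanBlock (k + 1))) (hnil : IsNilpotent M)
    (hb : b * jordanBlock (k + 1) = M * b) :
    ∃ c x : ℚ, b.det = c ^ (∑ i ∈ Finset.range (k + 1), i) * x ^ (k + 1) := by
  have hMzero : ∀ i l : Fin (k + 1), l ≤ i → M i l = 0 := by
    intro i l hl
    rcases hl.lt_or_eq with hl | rfl
    · exact isUpperTriangular_of_commute hM hl
    · exact diag_eq_zero_of_commute hM hnil _
  have hentry : ∀ (i : Fin (k + 1)) (j : Fin k), b i j.castSucc = ∑ l, M i l * b l j.succ := by
    intro i j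
    rw [← mul_jordanBlock_apply_succ b, hb, Matrix.mul_apply]
  have hlower : ∀ (j i : Fin (k + 1)), j < i → b i j = 0 := by
    intro j
    induction j using Fin.reverseInduction with
    | last => exact fun i hi => absurd hi (Fin.le_last i).not_gt
    | cast j ih =>
      intro i hi
      rw [hentry]
      refine Finset.sum_eq_zero fun l _ => ?_
      rcases le_or_gt l i with hl | hl
      · rw [hMzero i l hl, zero_mul]
      · rw [ih l ((Fin.castSucc_lt_iff_succ_le.mp hi).trans_lt hl), mul_zero]
  have hdiag : ∀ i : Fin k,
      b i.castSucc i.castSucc = M i.castSucc i.succ * b i.succ i.succ := by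
    intro i
    rw [hentry, Finset.sum_eq_single i.succ]
    · intro l _ hl
      rcases le_or_gt l i.castSucc with h | h
      · rw [hMzero _ _ h, zero_mul]
      · rw [hlower _ _ (lt_of_le_of_ne (Fin.castSucc_lt_iff_succ_le.mp h) hl.symm), mul_zero]
    · simp
  obtain ⟨c, hc⟩ : ∃ c : ℚ, ∀ i : Fin k, M i.castSucc i.succ = c := by
    cases k with
    | zero => exact ⟨0, fun i => i.elim0⟩
    | succ k => exact ⟨_, fun i => superdiag_eq_of_commute hM i 0⟩
  have hpow : ∀ i : Fin (k + 1), b i i = c ^ (k - i : ℕ) * b (Fin.last k) (Fin.last k) := by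
    intro i
    induction i using Fin.reverseInduction with
    | last => simp
    | cast i ih =>
      have : k - (i : ℕ) = k - (i + 1) + 1 := by omega
      rw [hdiag, hc, ih, Fin.val_castSucc, this, Fin.val_succ, pow_succ]
      ring
  refine ⟨c, b (Fin.last k) (Fin.last k), ?_⟩
  rw [Matrix.det_of_isUpperTriangular (fun i j hij => hlower j i hij)]
  rw [Finset.prod_congr rfl fun i _ => hpow i]
  rw [Finset.prod_mul_distrib, Finset.prod_pow_eq_pow_sum,
    Fin.sum_univ_eq_sum_range (fun i => k - i) (k + 1), Finset.prod_const, Finset.card_univ,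
    Fintype.card_fin]
  congr 2
  simpa using Finset.sum_range_reflect (fun i => i) (k + 1)

/-- Integers `n ≥ 3` admit a common divisor `m ≥ 2` of `n` and `n (n - 1) / 2`. -/
lemma exists_two_le_dvd_dvd_sum_range {n : ℕ} (hn : 3 ≤ n) :
    ∃ m, 2 ≤ m ∧ m ∣ n ∧ m ∣ ∑ i ∈ Finset.range n, i := by
  have h := Finset.sum_range_id_mul_two n
  rcases Nat.even_or_odd' n with ⟨t, rfl | rfl⟩
  · refine ⟨t, by omega, ⟨2, by ring⟩, ⟨2 * t - 1, ?_⟩⟩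
    refine Nat.eq_of_mul_eq_mul_right two_pos (h.trans ?_)
    ring
  · refine ⟨2 * t + 1, by omega, dvd_rfl, ⟨t, ?_⟩⟩
    refine Nat.eq_of_mul_eq_mul_right two_pos (h.trans ?_)
    rw [Nat.add_sub_cancel]
    ring

lemma prime_div_prime_ne_pow {p q m : ℕ} (hp : p.Prime) (hq : q.Prime) (hpq : p ≠ q)
    (hm : 2 ≤ m) (r : ℚ) : (p / q : ℚ) ≠ r ^ m := by
  intro h
  have : Fact p.Prime := ⟨hp⟩
  have : Fact q.Prime := ⟨hq⟩
  have hp0 : (p : ℚ) ≠ 0 := by exact_mod_cast hp.ne_zero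
  have hq0 : (q : ℚ) ≠ 0 := by exact_mod_cast hq.ne_zero
  have hv := congrArg (padicValRat p) h
  rw [padicValRat.div hp0 hq0, padicValRat.pow, padicValRat.of_nat, padicValRat.of_nat,
    padicValNat_self, padicValNat_primes hpq] at hv
  have hdvd : (m : ℤ) ∣ 1 := ⟨_, by simpa using hv⟩
  have := Int.le_of_dvd one_pos hdvd
  omega

/-- The regular unipotent upper triangular Jordan block. -/
def unipotentBlock (n : ℕ) : GL (Fin n) ℚ :=
  Matrix.GeneralLinearGroup.mkOfDetNeZero (1 + jordanBlock n)
    (by rw [det_one_add_jordanBlock]; exact one_ne_zero)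

lemma exists_det_conj_unit (k : ℕ) {β : ℚ} (hβ : β ≠ 0) :
    ∃ d : GL (Fin (k + 1)) ℚ, (d : Matrix (Fin (k + 1)) (Fin (k + 1)) ℚ).det = β := by
  have h : (Matrix.diagonal (Fin.cons β fun _ : Fin k => (1 : ℚ))).det = β := by
    simp [Matrix.det_diagonal, Fin.prod_univ_succ]
  exact ⟨Matrix.GeneralLinearGroup.mkOfDetNeZero _ (h.trans_ne hβ), h⟩

/-- The conjugate of the regular unipotent Jordan block by an invertible matrix. -/
noncomputable def conjUnipotent {n : ℕ} (d : GL (Fin n) ℚ) : SpecialLinearGroup (Fin n) ℚ :=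
  ⟨d * (1 + jordanBlock n) * (d⁻¹ : GL (Fin n) ℚ), by
    rw [Matrix.det_units_conj, det_one_add_jordanBlock]⟩

lemma toGL_conjUnipotent {n : ℕ} (d : GL (Fin n) ℚ) :
    SpecialLinearGroup.toGL (conjUnipotent d) = d * unipotentBlock n * d⁻¹ :=
  Units.ext rfl

lemma isNilpotent_units_conj {R : Type*} [Ring R] (d : Rˣ) {x : R} (hx : IsNilpotent x) :
    IsNilpotent (d * x * (d⁻¹ : Rˣ)) := by
  obtain ⟨m, hm⟩ := hx
  exact ⟨m, by rw [Units.conj_pow, hm, mul_zero, zero_mul]⟩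

lemma isNilpotent_conjUnipotent_sub_one {n : ℕ} (d : GL (Fin n) ℚ) :
    IsNilpotent ((conjUnipotent d : Matrix (Fin n) (Fin n) ℚ) - 1) := by
  have h : (conjUnipotent d : Matrix (Fin n) (Fin n) ℚ) - 1 =
      d * jordanBlock n * (d⁻¹ : GL (Fin n) ℚ) := by
    change (d : Matrix (Fin n) (Fin n) ℚ) * (1 + jordanBlock n) * (d⁻¹ : GL (Fin n) ℚ) - 1 = _
    rw [mul_add, add_mul, mul_one, Units.mul_inv, add_sub_cancel_left]
  rw [h]
  exact isNilpotent_units_conj d (isNilpotent_jordanBlock n)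

lemma exists_det_eq_of_commute_conj {k : ℕ} (b : GL (Fin (k + 1)) ℚ)
    (h : Commute (b * unipotentBlock (k + 1) * b⁻¹) (unipotentBlock (k + 1))) :
    ∃ c x : ℚ, (b : Matrix (Fin (k + 1)) (Fin (k + 1)) ℚ).det =
      c ^ (∑ i ∈ Finset.range (k + 1), i) * x ^ (k + 1) := by
  refine exists_det_eq_of_intertwine
    (M := b * jordanBlock (k + 1) * (b⁻¹ : GL (Fin (k + 1)) ℚ)) ?_
    (isNilpotent_units_conj b (isNilpotent_jordanBlock _)) ?_
  · have h' : Commute ((b : Matrix (Fin (k + 1)) (Fin (k + 1)) ℚ) * (1 + jordanBlock (k + 1)) *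
        (b⁻¹ : GL (Fin (k + 1)) ℚ)) (1 + jordanBlock (k + 1)) := congrArg Units.val h.eq
    rw [mul_add, add_mul, mul_one, Units.mul_inv] at h'
    have h1 := (h'.sub_left (Commute.one_left _)).sub_right (Commute.one_right _)
    rwa [add_sub_cancel_left, add_sub_cancel_left] at h1
  · rw [mul_assoc, Units.inv_mul, mul_one]

/-- The ratio of the determinants of the conjugating matrices is, up to `m`-th powers, an
invariant of the z-class. -/
lemma exists_det_div_det_eq_of_isZEquiv {k : ℕ} {d e : GL (Fin (k + 1)) ℚ}
    (h : IsZEquiv (conjUnipotent d) (conjUnipotent e)) :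
    ∃ c x : ℚ, (d : Matrix (Fin (k + 1)) (Fin (k + 1)) ℚ).det /
        (e : Matrix (Fin (k + 1)) (Fin (k + 1)) ℚ).det =
      c ^ (∑ i ∈ Finset.range (k + 1), i) * x ^ (k + 1) := by
  obtain ⟨a, ha⟩ := h
  have hmem := (ha (conjUnipotent d)).mp (Subgroup.mem_centralizer_singleton_iff.mpr rfl)
  have hcomm : Commute (a * conjUnipotent d * a⁻¹) (conjUnipotent e) := 
    Subgroup.mem_centralizer_singleton_iff.mp hmem
  have hGL := hcomm.map SpecialLinearGroup.toGL
  rw [map_mul, map_mul, map_inv, toGL_conjUnipotent, toGL_conjUnipotent] at hGL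
  set A : GL (Fin (k + 1)) ℚ := SpecialLinearGroup.toGL a
  have hdetA : (A : Matrix (Fin (k + 1)) (Fin (k + 1)) ℚ).det = 1 := a.det_coe
  have hb := hGL.map (MulAut.conj e⁻¹)
  simp only [MulAut.conj_apply, inv_inv] at hb
  obtain ⟨c, x, hcx⟩ := exists_det_eq_of_commute_conj (e⁻¹ * A * d) (by
    simpa [mul_assoc] using hb)
  refine ⟨c, x, ?_⟩
  rw [← hcx]
  simp [hdetA, Ring.inverse_eq_inv', div_eq_inv_mul]

end UnipotentZClasses

open UnipotentZClasses in
/-- For every `n ≥ 3`, the group `SL n ℚ` has infinitely many z-classes of unipotent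
elements: there is an infinite (ℕ-indexed) family of unipotent elements of `SL n ℚ`
that are pairwise not z-equivalent. -/
theorem infinitely_many_unipotent_zClasses_SL_rat (n : ℕ) (hn : 3 ≤ n) :
    ∃ g : ℕ → Matrix.SpecialLinearGroup (Fin n) ℚ,
      (∀ i, IsNilpotent ((g i : Matrix (Fin n) (Fin n) ℚ) - 1)) ∧
      (∀ i j, i ≠ j → ¬ IsZEquiv (g i) (g j)) := by
  obtain ⟨k, rfl⟩ : ∃ k, n = k + 1 := ⟨n - 1, by omega⟩
  have hprime (i : ℕ) : (Nat.nth Nat.Prime i).Prime := Nat.prime_nth_prime i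
  choose d hd using fun i : ℕ => exists_det_conj_unit k
    (β := (Nat.nth Nat.Prime i : ℚ)) (by exact_mod_cast (hprime i).ne_zero)
  refine ⟨fun i => conjUnipotent (d i), fun i => isNilpotent_conjUnipotent_sub_one _,
    fun i j hij h => ?_⟩
  obtain ⟨c, x, hcx⟩ := exists_det_div_det_eq_of_isZEquiv h
  obtain ⟨m, hm, ⟨s, hs⟩, ⟨t, ht⟩⟩ := exists_two_le_dvd_dvd_sum_range hn
  rw [hd, hd, ht, hs, mul_comm m t, mul_comm m s, pow_mul, pow_mul, ← mul_pow] at hcx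
  exact prime_div_prime_ne_pow (hprime i) (hprime j)
    (fun h => hij (Nat.nth_injective Nat.infinite_setOfPred_prime h)) hm _ hcx
end

section
/- For every integer n ≥ 2, the group GL_n(ℚ) has infinitely many z-classes: there exists an infinite family of semisimple elements of GL_n(ℚ) (elements with squarefree minimal polynomial) that are pairwise not z-equivalent in GL_n(ℚ). -/
open Polynomial in
theorem squarefree_X_sq_sub_C_mul_X_sub_one {K : Type*} [Field K] [CharZero K] {q : K}
    (hq0 : q ≠ 0) (hq1 : q ≠ 1) : Squarefree ((X ^ 2 - C q) * (X - C 1) : K[X]) := by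
  have h1 : (X ^ 2 - C q : K[X]).Separable :=
    separable_X_pow_sub_C q (by norm_num) hq0
  refine (h1.mul separable_X_sub_C ?_).squarefree
  have hne : 1 - q ≠ 0 := sub_ne_zero.mpr hq1.symm
  refine ⟨C (1 - q)⁻¹, -C (1 - q)⁻¹ * (X + C 1), ?_⟩
  have hc : (C (1 - q)⁻¹ * (1 - C q) : K[X]) = 1 := by
    rw [← C_1, ← C_sub, ← C_mul, inv_mul_cancel₀ hne]
  linear_combination hc + (C (1 - q)⁻¹ * (C 1 + 1) : K[X]) * (C_1 (R := K))

theorem Nat.Prime.cast_ne_sq_mul {p r : ℕ} (hp : p.Prime) (hr : ¬ p ∣ r) (y : ℚ) :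
    (p : ℚ) ≠ y ^ 2 * r := by
  intro h
  have : Fact p.Prime := ⟨hp⟩
  have hp0 : (p : ℚ) ≠ 0 := by exact_mod_cast hp.ne_zero
  have hy : y ≠ 0 := by
    rintro rfl
    simp [hp0] at h
  have hr0 : (r : ℚ) ≠ 0 := by
    intro h0
    simp [h0, hp0] at h
  have hv := congrArg (padicValRat p) h
  rw [padicValRat.mul (pow_ne_zero 2 hy) hr0, padicValRat.pow, padicValRat.of_nat,
    padicValRat.of_nat, padicValNat.eq_zero_of_not_dvd hr, padicValNat_self] at hv
  push_cast at hv
  omega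

theorem IsZEquiv.of_map {G H : Type*} [Group G] [Group H] (φ : G ≃* H) {g h : G}
    (hz : IsZEquiv (φ g) (φ h)) : IsZEquiv g h := by
  obtain ⟨a, ha⟩ := hz
  refine ⟨φ.symm a, fun x => ?_⟩
  have := ha (φ x)
  simp only [Subgroup.mem_centralizer_singleton_iff] at this ⊢
  rw [← φ.injective.eq_iff, ← φ.injective.eq_iff (a := φ.symm a * x * (φ.symm a)⁻¹ * h)]
  simpa using this

/-- A conjugate of `g` lies in the double centralizer of every element z-equivalent to `g`. -/
theorem IsZEquiv.exists_commute {G : Type*} [Group G] {g h : G} (hz : IsZEquiv g h) :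
    ∃ a : G, ∀ k : G, Commute k h → Commute k (a * g * a⁻¹) := by
  obtain ⟨a, ha⟩ := hz
  refine ⟨a, fun k hk => ?_⟩
  have h1 := (ha (a⁻¹ * k * a)).mpr (by
    rw [Subgroup.mem_centralizer_singleton_iff]
    simpa [mul_assoc] using hk.eq)
  rw [Subgroup.mem_centralizer_singleton_iff] at h1
  have h2 := congrArg (fun t => a * t * a⁻¹) h1
  simpa [mul_assoc, Commute, SemiconjBy] using h2

theorem Matrix.fromBlocks_sub_fromBlocks {l m n o α : Type*} [AddGroup α]
    (A A' : Matrix n l α) (B B' : Matrix n m α) (C C' : Matrix o l α) (D D' : Matrix o m α) :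
    fromBlocks A B C D - fromBlocks A' B' C' D' =
      fromBlocks (A - A') (B - B') (C - C') (D - D') := by
  ext (i | i) (j | j) <;> rfl

section BlockMatrix

variable {m : ℕ}

/-- The block-diagonal matrix made of the companion matrix of `X ^ 2 - q` and an identity block. -/
def sqrtBlock (m : ℕ) (q : ℚ) : Matrix (Fin 2 ⊕ Fin m) (Fin 2 ⊕ Fin m) ℚ :=
  Matrix.fromBlocks !![0, q; 1, 0] 0 0 1

theorem sqrtBlock_relation (m : ℕ) (q : ℚ) :
    (sqrtBlock m q * sqrtBlock m q - q • 1) * (sqrtBlock m q - 1) = 0 := by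
  have h : !![0, q; 1, 0] * !![0, q; 1, 0] - q • (1 : Matrix (Fin 2) (Fin 2) ℚ) = 0 := by
    ext i j
    fin_cases i <;> fin_cases j <;> simp
  rw [sqrtBlock, ← Matrix.fromBlocks_one, Matrix.fromBlocks_smul, Matrix.fromBlocks_multiply,
    Matrix.fromBlocks_sub_fromBlocks, Matrix.fromBlocks_sub_fromBlocks, Matrix.fromBlocks_multiply,
    Matrix.mul_zero, add_zero, h]
  simp

open Polynomial in
theorem squarefree_minpoly_sqrtBlock {q : ℚ} (hq0 : q ≠ 0) (hq1 : q ≠ 1) :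
    Squarefree (minpoly ℚ (sqrtBlock m q)) := by
  refine (squarefree_X_sq_sub_C_mul_X_sub_one hq0 hq1).squarefree_of_dvd (minpoly.dvd _ _ ?_)
  simpa [Algebra.algebraMap_eq_smul_one, pow_two] using sqrtBlock_relation m q

theorem isUnit_sqrtBlock {q : ℚ} (hq : q ≠ 0) : IsUnit (sqrtBlock m q) := by
  rw [Matrix.isUnit_iff_isUnit_det, sqrtBlock, Matrix.det_fromBlocks_zero₂₁]
  simp [hq]

/-- `sqrtBlock m q` as an invertible matrix. -/
noncomputable def sqrtBlockUnit (m : ℕ) {q : ℚ} (hq : q ≠ 0) : GL (Fin 2 ⊕ Fin m) ℚ :=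
  (isUnit_sqrtBlock (m := m) hq).unit

theorem sqrtBlockUnit_val {q : ℚ} (hq : q ≠ 0) :
    (sqrtBlockUnit m hq : Matrix (Fin 2 ⊕ Fin m) (Fin 2 ⊕ Fin m) ℚ) = sqrtBlock m q := rfl

theorem eq_one_of_commute_companion {p q : ℕ} (hp : p.Prime) (hq : q.Prime) (hpq : p ≠ q)
    {A : Matrix (Fin 2) (Fin 2) ℚ} (hA : Commute A !![0, (q : ℚ); 1, 0])
    (hrel : (A * A - (p : ℚ) • 1) * (A - 1) = 0) : A = 1 := by
  have c00 := congrFun (congrFun hA.eq 0) 0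
  have c10 := congrFun (congrFun hA.eq 1) 0
  have r00 := congrFun (congrFun hrel 0) 0
  have r10 := congrFun (congrFun hrel 1) 0
  simp [Matrix.mul_apply, Fin.sum_univ_two] at c00 c10 r00 r10
  generalize hx : A 0 0 = x at *
  generalize hy : A 1 0 = y at *
  generalize hz : A 0 1 = z at *
  generalize hw : A 1 1 = w at *
  subst c00 c10
  have hq1 : ∀ t : ℚ, (q : ℚ) ≠ t ^ 2 := fun t => by
    simpa using hq.cast_ne_sq_mul (r := 1) (by simpa using hq.one_lt.ne') t
  have hp1 : ∀ t : ℚ, (p : ℚ) ≠ t ^ 2 := fun t => by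
    simpa using hp.cast_ne_sq_mul (r := 1) (by simpa using hp.one_lt.ne') t
  have hpq' : ∀ t : ℚ, (p : ℚ) ≠ t ^ 2 * q :=
    hp.cast_ne_sq_mul (fun h => hpq ((Nat.prime_dvd_prime_iff_eq hp hq).mp h))
  by_cases hN : (w - 1) ^ 2 - q * y ^ 2 = 0
  · have hy0 : y = 0 := by
      by_contra hne
      apply hq1 ((w - 1) / y)
      field_simp
      linarith
    have hw1 : w = 1 := by
      rw [hy0] at hN
      have : (w - 1) ^ 2 = 0 := by simpa using hN
      linarith [pow_eq_zero_iff (two_ne_zero) |>.mp this]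
    ext i j
    fin_cases i <;> fin_cases j <;> simp [hx, hy, hz, hw, hy0, hw1]
  · exfalso
    have hu : w ^ 2 + q * y ^ 2 - p = 0 := by
      refine (mul_eq_zero.mp ?_).resolve_right hN
      linear_combination (w - 1) * r00 - q * y * r10
    have hv : 2 * w * y = 0 := by
      refine (mul_eq_zero.mp ?_).resolve_right hN
      linear_combination (w - 1) * r10 - y * r00
    rcases mul_eq_zero.mp hv with h | h
    · have hw0 : w = 0 := by simpa using h
      apply hpq' y
      rw [hw0] at hu
      linarith
    · apply hp1 w
      rw [h] at hu
      linarith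

theorem eq_one_of_commute_units {p : ℕ} (hp : p.Prime) {D : Matrix (Fin m) (Fin m) ℚ}
    (hD : ∀ U : GL (Fin m) ℚ, Commute (U : Matrix (Fin m) (Fin m) ℚ) D)
    (hrel : (D * D - (p : ℚ) • 1) * (D - 1) = 0) : D = 1 := by
  have hs : D ∈ Set.range (Matrix.scalar (Fin m)) := by
    rw [Matrix.mem_range_scalar_iff_commute_transvectionStruct]
    intro t
    have ht : IsUnit t.toMatrix := by
      rw [Matrix.isUnit_iff_isUnit_det, Matrix.TransvectionStruct.det]
      exact isUnit_one
    exact hD ht.unit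
  obtain ⟨c, rfl⟩ := hs
  ext i j
  have hc : (c * c - p) * (c - 1) = 0 := by
    have := congrFun (congrFun hrel i) i
    simpa [Matrix.mul_apply, Matrix.diagonal_apply, Matrix.one_apply, Matrix.sub_apply,
      sub_mul, mul_sub] using this
  rcases mul_eq_zero.mp hc with h | h
  · refine absurd ?_ (hp.cast_ne_sq_mul (r := 1) (by simpa using hp.one_lt.ne') c)
    push_cast
    linarith
  · rw [sub_eq_zero.mp h, map_one]

theorem not_isZEquiv_sqrtBlockUnit {p q : ℕ} (hp : p.Prime) (hq : q.Prime) (hpq : p ≠ q)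
    (hp0 : (p : ℚ) ≠ 0) (hq0 : (q : ℚ) ≠ 0) :
    ¬ IsZEquiv (sqrtBlockUnit m hp0) (sqrtBlockUnit m hq0) := by
  intro hz
  obtain ⟨a, ha⟩ := hz.exists_commute
  set h := a * sqrtBlockUnit m hp0 * a⁻¹ with hh
  have ha' : ∀ k : GL (Fin 2 ⊕ Fin m) ℚ,
      Commute (k : Matrix (Fin 2 ⊕ Fin m) (Fin 2 ⊕ Fin m) ℚ) (sqrtBlock m q) →
      Commute (k : Matrix (Fin 2 ⊕ Fin m) (Fin 2 ⊕ Fin m) ℚ) h.val := fun k hk =>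
    (ha k (Commute.units_of_val hk)).units_val
  have hrel : (h.val * h.val - (p : ℚ) • 1) * (h.val - 1) = 0 := by
    have e1 : h.val * a.val = a.val * sqrtBlock m p := by
      rw [← sqrtBlockUnit_val hp0, ← Units.val_mul, ← Units.val_mul, hh, inv_mul_cancel_right]
    have e2 : (h.val - 1) * a.val = a.val * (sqrtBlock m p - 1) := by
      rw [sub_mul, mul_sub, e1, one_mul, mul_one]
    have e3 : (h.val * h.val - (p : ℚ) • 1) * a.val =
        a.val * (sqrtBlock m p * sqrtBlock m p - (p : ℚ) • 1) := by
      rw [sub_mul, mul_sub, mul_assoc, e1, ← mul_assoc, e1, mul_assoc]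
      simp
    apply a.isUnit.mul_right_cancel
    rw [mul_assoc, e2, ← mul_assoc, e3, mul_assoc, sqrtBlock_relation, mul_zero, zero_mul]
  obtain ⟨A, B, C, D, hM⟩ : ∃ A B C D, h.val = Matrix.fromBlocks A B C D :=
    ⟨_, _, _, _, (Matrix.fromBlocks_toBlocks h.val).symm⟩
  have hblock : ∀ U : GL (Fin m) ℚ,
      Commute (Matrix.fromBlocks 1 0 0 U.val) (Matrix.fromBlocks A B C D) := by
    intro U
    have hu : IsUnit (Matrix.fromBlocks (1 : Matrix (Fin 2) (Fin 2) ℚ) 0 0 U.val) := by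
      rw [Matrix.isUnit_iff_isUnit_det, Matrix.det_fromBlocks_zero₂₁]
      simpa using (Matrix.isUnit_iff_isUnit_det _).mp U.isUnit
    rw [← hM]
    refine ha' hu.unit ?_
    simp [sqrtBlock, Commute, SemiconjBy, Matrix.fromBlocks_multiply]
  have hneg := (hblock (-1)).eq
  rw [Matrix.fromBlocks_multiply, Matrix.fromBlocks_multiply, Matrix.fromBlocks_inj] at hneg
  obtain ⟨-, hB, hC, -⟩ := hneg
  have hB0 : B = 0 := by
    ext i j
    exact self_eq_neg.mp (by simpa using congrFun (congrFun hB i) j)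
  have hC0 : C = 0 := by
    ext i j
    exact neg_eq_self.mp (by simpa using congrFun (congrFun hC i) j)
  subst hB0 hC0
  have hDcomm : ∀ U : GL (Fin m) ℚ, Commute U.val D := fun U => by
    have := (hblock U).eq
    rw [Matrix.fromBlocks_multiply, Matrix.fromBlocks_multiply, Matrix.fromBlocks_inj] at this
    simpa [Commute, SemiconjBy] using this.2.2.2
  have hAcomm : Commute A !![0, (q : ℚ); 1, 0] := by
    have := (ha' (sqrtBlockUnit m hq0) (Commute.refl _)).eq
    rw [sqrtBlockUnit_val, sqrtBlock, hM, Matrix.fromBlocks_multiply,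
      Matrix.fromBlocks_multiply, Matrix.fromBlocks_inj] at this
    simpa only [Commute, SemiconjBy, Matrix.mul_zero, Matrix.zero_mul, add_zero] using this.1.symm
  rw [hM, ← Matrix.fromBlocks_one, Matrix.fromBlocks_smul, Matrix.fromBlocks_multiply,
    Matrix.fromBlocks_sub_fromBlocks, Matrix.fromBlocks_sub_fromBlocks, Matrix.fromBlocks_multiply,
    ← Matrix.fromBlocks_zero, Matrix.fromBlocks_inj] at hrel
  have hA1 : A = 1 :=
    eq_one_of_commute_companion hp hq hpq hAcomm (by simpa using hrel.1)
  have hD1 : D = 1 := eq_one_of_commute_units hp hDcomm (by simpa using hrel.2.2.2)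
  have h1 : h = 1 := Units.ext (by rw [hM, hA1, hD1, Matrix.fromBlocks_one, Units.val_one])
  have hg : sqrtBlockUnit m hp0 = 1 := by
    rwa [hh, conj_eq_one_iff] at h1
  have hval : sqrtBlock m p = 1 := by
    rw [← sqrtBlockUnit_val hp0, hg, Units.val_one]
  have := congrFun (congrFun hval (Sum.inl 0)) (Sum.inl 0)
  simp [sqrtBlock] at this

end BlockMatrix

/-- For every `n ≥ 2`, the group `GL n ℚ` has infinitely many z-classes: there is an
infinite (ℕ-indexed) family of semisimple elements (squarefree minimal polynomial)
of `GL n ℚ` that are pairwise not z-equivalent. -/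
theorem infinitely_many_zClasses_GL_rat (n : ℕ) (hn : 2 ≤ n) :
    ∃ g : ℕ → GL (Fin n) ℚ,
      (∀ i, Squarefree (minpoly ℚ ((g i : Matrix (Fin n) (Fin n) ℚ)))) ∧
      (∀ i j, i ≠ j → ¬ IsZEquiv (g i) (g j)) := by
  obtain ⟨m, rfl⟩ := Nat.exists_eq_add_of_le hn
  let e := Matrix.reindexAlgEquiv ℚ ℚ (finSumFinEquiv (m := 2) (n := m))
  let φ := Units.mapEquiv e.toMulEquiv
  have hP : ∀ i, (Nat.nth Nat.Prime i).Prime := Nat.prime_nth_prime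
  have h0 : ∀ i, (Nat.nth Nat.Prime i : ℚ) ≠ 0 := fun i => by exact_mod_cast (hP i).ne_zero
  refine ⟨fun i => φ (sqrtBlockUnit m (h0 i)), fun i => ?_, fun i j hij hz => ?_⟩
  · change Squarefree (minpoly ℚ (e (sqrtBlock m _)))
    rw [minpoly.algEquiv_eq]
    exact squarefree_minpoly_sqrtBlock (h0 i) (by exact_mod_cast (hP i).one_lt.ne')
  · refine not_isZEquiv_sqrtBlockUnit (hP i) (hP j) (fun h => hij ?_) (h0 i) (h0 j)
      (IsZEquiv.of_map φ hz)
    exact Nat.nth_injective Nat.infinite_setOfPred_prime h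
end
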